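/- Let G be a finite simple 3-regular bipartite graph on exactly 2h+8 vertices (h a natural number) having exactly six cycles of length 4, any two distinct 4-cycles of G sharing at most one edge. Let y be the number of dual-square subgraphs of G, and assume that G has exactly h + y cycles of length 6. Then the number of 6-matchings of G satisfies 240·M(G,6) = 243h⁶ − 243h⁵ − 1485h⁴ + 6075h³ − 11238h² + 9768h − 3840 + 240y (i.e. M(G,6) = (81/80)h⁶ − (81/80)h⁵ − (99/16)h⁴ + (405/16)h³ − (1873/40)h² + (407/10)h − 16 + y). -/

import Mathlib

open SimpleGraph

/-- The number of `k`-matchings of a graph `G`: `k`-element sets of pairwise disjoint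
edges of `G`, identified with the matching subgraphs of `G` having exactly `k` edges. -/
noncomputable def numMatchings {V : Type*} (G : SimpleGraph V) (k : ℕ) : ℕ :=
  Set.ncard {H : G.Subgraph | H.IsMatching ∧ H.edgeSet.ncard = k}

/-- The number of subgraphs of `G` isomorphic to the graph `X`. -/
noncomputable def numSubgraphs {V W : Type*} (G : SimpleGraph V) (X : SimpleGraph W) : ℕ :=
  Set.ncard {H : G.Subgraph | Nonempty (H.coe ≃g X)}

/-- The dual-square: two 4-cycles sharing exactly one edge; equivalently a 6-cycle
together with a chord joining two antipodal vertices. -/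
noncomputable def dualSquare : SimpleGraph (Fin 6) :=
  cycleGraph 6 ⊔ SimpleGraph.fromEdgeSet {s(0, 3)}

section MatchingSeries

open scoped PowerSeries

variable {V : Type*} [Fintype V] (G : SimpleGraph V) [DecidableRel G.Adj]

open Classical in
/-- The `k`-matchings of `G`, as sets of edges, that cover no vertex of `S`. -/
noncomputable def matchingsAvoiding (S : Finset V) (k : ℕ) : Finset (Finset (Sym2 V)) :=
  (G.edgeFinset.powersetCard k).filter fun M =>
    (∀ e ∈ M, ∀ e' ∈ M, ∀ v, v ∈ e → v ∈ e' → e = e') ∧ ∀ e ∈ M, ∀ v ∈ S, v ∉ e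

variable {G}

lemma mem_matchingsAvoiding {S : Finset V} {k : ℕ} {M : Finset (Sym2 V)} :
    M ∈ matchingsAvoiding G S k ↔ (M ⊆ G.edgeFinset ∧ M.card = k) ∧
      (∀ e ∈ M, ∀ e' ∈ M, ∀ v, v ∈ e → v ∈ e' → e = e') ∧ ∀ e ∈ M, ∀ v ∈ S, v ∉ e := by
  simp only [matchingsAvoiding, Finset.mem_filter, Finset.mem_powersetCard]

lemma card_matchingsAvoiding_zero (S : Finset V) : (matchingsAvoiding G S 0).card = 1 := by
  rw [Finset.card_eq_one]
  refine ⟨∅, ?_⟩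
  ext M
  rw [mem_matchingsAvoiding, Finset.mem_singleton, Finset.card_eq_zero]
  constructor
  · exact fun h => h.1.2
  · rintro rfl
    simp

variable [DecidableEq V]

/-- The neighbours of `v` that are still available once `S` and `v` have been deleted. -/
def nextVertices (G : SimpleGraph V) [DecidableRel G.Adj] (S : Finset V) (v : V) : Finset V :=
  G.neighborFinset v \ insert v S

lemma mem_nextVertices {S : Finset V} {v u : V} :
    u ∈ nextVertices G S v ↔ G.Adj v u ∧ u ∉ S := by
  simp only [nextVertices, Finset.mem_sdiff, mem_neighborFinset, Finset.mem_insert, not_or]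
  exact ⟨fun h => ⟨h.1, h.2.2⟩, fun h => ⟨h.1, h.1.ne', h.2⟩⟩

lemma card_matchingsAvoiding_through {S : Finset V} {v u : V} (hv : v ∉ S)
    (hu : u ∈ nextVertices G S v) (k : ℕ) :
    ((matchingsAvoiding G S (k + 1)).filter fun M => s(v, u) ∈ M).card =
      (matchingsAvoiding G (insert u (insert v S)) k).card := by
  rw [mem_nextVertices] at hu
  obtain ⟨hadj, huS⟩ := hu
  have hnot : ∀ M ∈ matchingsAvoiding G (insert u (insert v S)) k, s(v, u) ∉ M := by
    intro M hM h
    rw [mem_matchingsAvoiding] at hM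
    exact hM.2.2 _ h v (by simp) (by simp)
  refine Finset.card_bij' (fun M _ => M.erase s(v, u)) (fun M _ => insert s(v, u) M) ?_ ?_ ?_ ?_
  · intro M hM
    rw [Finset.mem_filter, mem_matchingsAvoiding] at hM
    obtain ⟨⟨⟨hsub, hcard⟩, hdisj, havoid⟩, hmem⟩ := hM
    rw [mem_matchingsAvoiding]
    refine ⟨⟨(Finset.erase_subset _ _).trans hsub, by simp [Finset.card_erase_of_mem hmem, hcard]⟩,
      fun e he e' he' => hdisj e (Finset.mem_of_mem_erase he) e' (Finset.mem_of_mem_erase he'), ?_⟩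
    intro e he w hw hwe
    rw [Finset.mem_erase] at he
    rw [Finset.mem_insert, Finset.mem_insert] at hw
    rcases hw with rfl | rfl | hw
    · exact he.1 (hdisj e he.2 _ hmem w hwe (by simp))
    · exact he.1 (hdisj e he.2 _ hmem w hwe (by simp))
    · exact havoid e he.2 w hw hwe
  · intro M hM
    have hn := hnot M hM
    rw [mem_matchingsAvoiding] at hM
    obtain ⟨⟨hsub, hcard⟩, hdisj, havoid⟩ := hM
    rw [Finset.mem_filter, mem_matchingsAvoiding]
    have key : ∀ e ∈ M, ∀ w, w ∈ e → w ∈ s(v, u) → False := by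
      intro e he w hwe hw
      rw [Sym2.mem_iff] at hw
      rcases hw with rfl | rfl
      · exact havoid e he w (by simp) hwe
      · exact havoid e he w (by simp) hwe
    refine ⟨⟨⟨?_, by rw [Finset.card_insert_of_notMem hn, hcard]⟩, ?_, ?_⟩,
      Finset.mem_insert_self _ _⟩
    · exact Finset.insert_subset (by simpa using hadj) hsub
    · intro e he e' he' w hw hw'
      rcases Finset.mem_insert.1 he with rfl | he
      · rcases Finset.mem_insert.1 he' with rfl | he'
        · rfl
        · exact (key e' he' w hw' hw).elim
      · rcases Finset.mem_insert.1 he' with rfl | he'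
        · exact (key e he w hw hw').elim
        · exact hdisj e he e' he' w hw hw'
    · intro e he w hw
      rcases Finset.mem_insert.1 he with rfl | he
      · rw [Sym2.mem_iff]
        rintro (rfl | rfl)
        · exact hv hw
        · exact huS hw
      · exact havoid e he w (by simp [hw])
  · intro M hM
    exact Finset.insert_erase (Finset.mem_filter.1 hM).2
  · intro M hM
    exact Finset.erase_insert (hnot M hM)

lemma card_matchingsAvoiding_succ {S : Finset V} {v : V} (hv : v ∉ S) (k : ℕ) :
    (matchingsAvoiding G S (k + 1)).card = (matchingsAvoiding G (insert v S) (k + 1)).card +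
      ∑ u ∈ nextVertices G S v, (matchingsAvoiding G (insert u (insert v S)) k).card := by
  classical
  have h1 : (matchingsAvoiding G S (k + 1)).filter (fun M => ¬ ∃ e ∈ M, v ∈ e) =
      matchingsAvoiding G (insert v S) (k + 1) := by
    ext M
    simp only [Finset.mem_filter, mem_matchingsAvoiding, Finset.mem_insert, forall_eq_or_imp]
    grind
  have h2 : (matchingsAvoiding G S (k + 1)).filter (fun M => ∃ e ∈ M, v ∈ e) =
      (nextVertices G S v).biUnion fun u =>
        (matchingsAvoiding G S (k + 1)).filter fun M => s(v, u) ∈ M := by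
    ext M
    simp only [Finset.mem_filter, Finset.mem_biUnion]
    constructor
    · rintro ⟨hM, e, he, hve⟩
      obtain ⟨u, rfl⟩ := Sym2.mem_iff_exists.1 hve
      refine ⟨u, ?_, hM, he⟩
      rw [mem_matchingsAvoiding] at hM
      rw [mem_nextVertices]
      refine ⟨by simpa using hM.1.1 he, fun hu => hM.2.2 _ he u hu (by simp)⟩
    · rintro ⟨u, hu, hM, he⟩
      exact ⟨hM, _, he, by simp⟩
  rw [← Finset.card_filter_add_card_filter_not (fun M : Finset (Sym2 V) => ∃ e ∈ M, v ∈ e), h1, h2,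
    add_comm, Finset.card_biUnion]
  · congr 1
    exact Finset.sum_congr rfl fun u hu => card_matchingsAvoiding_through hv hu k
  · intro u hu w hw huw
    rw [Function.onFun, Finset.disjoint_left]
    intro M hM hM'
    rw [Finset.mem_filter, mem_matchingsAvoiding] at hM
    rw [Finset.mem_filter] at hM'
    have := hM.1.2.1 _ hM.2 _ hM'.2 v (by simp) (by simp)
    exact huw (Sym2.congr_right.1 this)

lemma card_covered {k : ℕ} {M : Finset (Sym2 V)} (hM : M ∈ matchingsAvoiding G ∅ k) :
    Finset.card {v | ∃ e ∈ M, v ∈ e} = 2 * k := by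
  classical
  rw [mem_matchingsAvoiding] at hM
  obtain ⟨⟨hsub, rfl⟩, hdisj, -⟩ := hM
  have : (Finset.univ.filter fun v => ∃ e ∈ M, v ∈ e) = M.biUnion Sym2.toFinset := by
    ext v
    simp
  rw [this, Finset.card_biUnion, Finset.sum_const_nat (m := 2), mul_comm]
  · intro e he
    exact Sym2.card_toFinset_of_not_isDiag e (G.not_isDiag_of_mem_edgeSet (by simpa using hsub he))
  · intro e he e' he' hne
    rw [Function.onFun, Finset.disjoint_left]
    intro v hv hv'
    exact hne (hdisj e he e' he' v (by simpa using hv) (by simpa using hv'))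

lemma sum_card_matchingsAvoiding_singleton (k : ℕ) :
    ∑ v, (matchingsAvoiding G {v} k).card + 2 * k * (matchingsAvoiding G ∅ k).card =
      Fintype.card V * (matchingsAvoiding G ∅ k).card := by
  classical
  have h1 (v : V) : (matchingsAvoiding G {v} k) =
      (matchingsAvoiding G ∅ k).filter (fun M => ¬ ∃ e ∈ M, v ∈ e) := by
    ext M
    simp only [Finset.mem_filter, mem_matchingsAvoiding]
    grind
  have h2 : ∑ v, ((matchingsAvoiding G ∅ k).filter (fun M => ∃ e ∈ M, v ∈ e)).card =
      2 * k * (matchingsAvoiding G ∅ k).card := by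
    simp_rw [Finset.card_filter]
    rw [Finset.sum_comm, mul_comm, ← smul_eq_mul, ← Finset.sum_const]
    refine Finset.sum_congr rfl fun M hM => ?_
    rw [← card_covered hM, Finset.card_filter]
  rw [← h2, ← Finset.sum_add_distrib]
  simp_rw [h1]
  rw [Finset.sum_congr rfl fun v _ => by
    rw [add_comm, Finset.card_filter_add_card_filter_not]]
  simp

lemma numMatchings_eq_card {V : Type*} [Fintype V] {G : SimpleGraph V} [DecidableRel G.Adj]
    (k : ℕ) : numMatchings G k = (matchingsAvoiding G ∅ k).card := by
  classical
  rw [numMatchings, ← Set.ncard_coe_finset]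
  refine Set.ncard_congr (fun H _ => H.edgeSet.toFinset) ?_ ?_ ?_
  · rintro H ⟨hH, rfl⟩
    rw [Finset.mem_coe, mem_matchingsAvoiding]
    refine ⟨⟨?_, (Set.ncard_eq_toFinset_card' _).symm⟩, ?_, by simp⟩
    · intro e he
      rw [Set.mem_toFinset] at he
      simpa using H.edgeSet_subset he
    · intro e he e' he' v hv hv'
      rw [Set.mem_toFinset] at he he'
      obtain ⟨u, rfl⟩ := Sym2.mem_iff_exists.1 hv
      obtain ⟨w, rfl⟩ := Sym2.mem_iff_exists.1 hv'
      rw [Subgraph.mem_edgeSet] at he he'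
      rw [(hH (H.edge_vert he)).unique he he']
  · intro H H' hH hH' heq
    exact Subgraph.IsMatching.injOn_edgeSet hH.1 hH'.1 (Set.toFinset_inj.1 heq)
  · intro M hM
    rw [Finset.mem_coe, mem_matchingsAvoiding] at hM
    obtain ⟨⟨hsub, rfl⟩, hdisj, -⟩ := hM
    let H : G.Subgraph :=
      { verts := {v | ∃ e ∈ M, v ∈ e}
        Adj := fun v w => s(v, w) ∈ M
        adj_sub := fun h => by simpa using hsub h
        edge_vert := fun h => ⟨_, h, by simp⟩
        symm := ⟨fun v w h => by rwa [Sym2.eq_swap]⟩ }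
    have hH : H.edgeSet.toFinset = M := by
      ext e
      induction e with
      | h v w => simp [H]
    refine ⟨H, ⟨?_, by rw [Set.ncard_eq_toFinset_card', hH]⟩, hH⟩
    rintro v ⟨e, he, hve⟩
    obtain ⟨u, rfl⟩ := Sym2.mem_iff_exists.1 hve
    exact ⟨u, he, fun w hw => Sym2.congr_right.1 (hdisj _ hw _ he v (by simp) (by simp))⟩

/-- The generating function of the matchings of `G` that cover no vertex of `S`. -/
noncomputable def matchingSeries (G : SimpleGraph V) [DecidableRel G.Adj] (S : Finset V) : ℚ⟦X⟧ :=
  PowerSeries.mk fun k => ((matchingsAvoiding G S k).card : ℚ)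

lemma constantCoeff_matchingSeries {V : Type*} [Fintype V] {G : SimpleGraph V}
    [DecidableRel G.Adj] (S : Finset V) :
    PowerSeries.constantCoeff (matchingSeries G S) = 1 := by
  rw [← PowerSeries.coeff_zero_eq_constantCoeff_apply, matchingSeries, PowerSeries.coeff_mk,
    card_matchingsAvoiding_zero, Nat.cast_one]

lemma matchingSeries_mul_inv {V : Type*} [Fintype V] {G : SimpleGraph V} [DecidableRel G.Adj]
    (S : Finset V) : matchingSeries G S * (matchingSeries G S)⁻¹ = 1 :=
  PowerSeries.mul_inv_cancel _ (by rw [constantCoeff_matchingSeries]; exact one_ne_zero)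

lemma matchingSeries_eq {S : Finset V} {v : V} (hv : v ∉ S) :
    matchingSeries G S = matchingSeries G (insert v S) +
      PowerSeries.X * ∑ u ∈ nextVertices G S v, matchingSeries G (insert u (insert v S)) := by
  ext k
  cases k with
  | zero => simp [constantCoeff_matchingSeries]
  | succ k =>
    rw [map_add, PowerSeries.coeff_succ_X_mul, map_sum]
    simp only [matchingSeries, PowerSeries.coeff_mk]
    rw [card_matchingsAvoiding_succ hv k]
    push_cast
    rfl

/-- The quotient of the matching generating functions of `G - S - v` and `G - S`. -/
noncomputable def matchingRatio (G : SimpleGraph V) [DecidableRel G.Adj] (S : Finset V) (v : V) :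
    ℚ⟦X⟧ :=
  matchingSeries G (insert v S) * (matchingSeries G S)⁻¹

lemma matchingRatio_mul {S : Finset V} {v : V} (hv : v ∉ S) :
    matchingRatio G S v *
      (1 + PowerSeries.X * ∑ u ∈ nextVertices G S v, matchingRatio G (insert v S) u) = 1 := by
  have h := matchingSeries_eq (G := G) hv
  have h1 := matchingSeries_mul_inv (G := G) S
  have h2 := matchingSeries_mul_inv (G := G) (insert v S)
  simp only [matchingRatio]
  rw [← Finset.sum_mul]
  set A := matchingSeries G S
  set B := matchingSeries G (insert v S)
  set T := ∑ u ∈ nextVertices G S v, matchingSeries G (insert u (insert v S))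
  linear_combination h1 - A⁻¹ * h + A⁻¹ * PowerSeries.X * T * h2

/-- The logarithmic derivative of the matching generating function, as a sum over vertices. -/
lemma two_mul_coeff_matchingSeries (k : ℕ) :
    2 * (k : ℚ) * PowerSeries.coeff k (matchingSeries G ∅) =
      PowerSeries.coeff k (matchingSeries G ∅ * ∑ v, (1 - matchingRatio G ∅ v)) := by
  have h : matchingSeries G ∅ * ∑ v, (1 - matchingRatio G ∅ v) =
      ∑ v, (matchingSeries G ∅ - matchingSeries G {v}) := by
    rw [Finset.mul_sum]
    refine Finset.sum_congr rfl fun v _ => ?_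
    rw [matchingRatio, insert_empty_eq]
    linear_combination -matchingSeries G {v} * matchingSeries_mul_inv (G := G) ∅
  have hc := sum_card_matchingsAvoiding_singleton (G := G) k
  rw [h, Finset.sum_sub_distrib, map_sub, map_sum, map_sum]
  simp only [matchingSeries, PowerSeries.coeff_mk, Finset.sum_const, Finset.card_univ, nsmul_eq_mul]
  rw [eq_sub_iff_add_eq, add_comm]
  exact_mod_cast hc

end MatchingSeries

section TruncatedRatios

variable {R : Type*} [CommRing R]

lemma pow_dvd_sub_of_mul_eq_one {x F σ s p : R} {k : ℕ} (hF : F * (1 + x * σ) = 1)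
    (hs : x ^ k ∣ σ - s) (hp : x ^ (k + 1) ∣ (1 + x * s) * p - 1) : x ^ (k + 1) ∣ F - p := by
  obtain ⟨a, ha⟩ := hs
  obtain ⟨b, hb⟩ := hp
  refine ⟨-F * b - p * F * a, ?_⟩
  linear_combination p * hF - F * hb - p * F * x * ha

/-- The ratio at distance five from the root, modulo `x ^ 2`. -/
def ratioFive (x e : R) : R := 1 + (e - 2) * x

/-- The ratio at distance four from the root, modulo `x ^ 3`. -/
def ratioFour (x e q : R) : R := 1 + (e - 2) * x + (8 - 5 * e - q) * x ^ 2

/-- The ratio at distance three from the root, modulo `x ^ 4`. -/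
def ratioThree (x a b c : R) : R :=
  1 + (a - 2) * x + (8 - 5 * a - b) * x ^ 2 + (27 * a + 9 * b + c - 40) * x ^ 3

/-- The ratio at distance two from the root, modulo `x ^ 5`. -/
def ratioTwo (x a b c : R) : R :=
  1 - 2 * x + (8 - a) * x ^ 2 + (9 * a + b - 40) * x ^ 3 + (224 - 66 * a - 13 * b - c) * x ^ 4

/-- The ratio at distance one from the root, modulo `x ^ 6`. -/
def ratioOne (x a b c : R) : R :=
  1 - 2 * x + 8 * x ^ 2 + (a - 40) * x ^ 3 + (224 - 13 * a - b) * x ^ 4 +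
    (122 * a + 17 * b + c - 1344) * x ^ 5

/-- The ratio at the root, modulo `x ^ 7`. -/
def ratioZero (x a b c : R) : R :=
  1 - 3 * x + 15 * x ^ 2 - 87 * x ^ 3 + (543 - a) * x ^ 4 + (19 * a + b - 3543) * x ^ 5 +
    (23823 - 239 * a - 23 * b - c) * x ^ 6

section Sums

variable {ι : Type*} (T : Finset ι) (x : R) (a b c : ι → R)

lemma sum_ratioFive : ∑ i ∈ T, ratioFive x (a i) =
    T.card * (1 - 2 * x) + (∑ i ∈ T, a i) * x := by
  simp only [ratioFive, Finset.sum_add_distrib, Finset.sum_sub_distrib, ← Finset.sum_mul,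
    Finset.sum_const, nsmul_eq_mul]
  ring

lemma sum_ratioFour : ∑ i ∈ T, ratioFour x (a i) (b i) =
    T.card * (1 - 2 * x + 8 * x ^ 2) + (∑ i ∈ T, a i) * (x - 5 * x ^ 2) -
      (∑ i ∈ T, b i) * x ^ 2 := by
  simp only [ratioFour, Finset.sum_add_distrib, Finset.sum_sub_distrib, ← Finset.sum_mul,
    ← Finset.mul_sum, Finset.sum_const, nsmul_eq_mul]
  ring

lemma sum_ratioThree : ∑ i ∈ T, ratioThree x (a i) (b i) (c i) =
    T.card * (1 - 2 * x + 8 * x ^ 2 - 40 * x ^ 3) +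
      (∑ i ∈ T, a i) * (x - 5 * x ^ 2 + 27 * x ^ 3) + (∑ i ∈ T, b i) * (9 * x ^ 3 - x ^ 2) +
      (∑ i ∈ T, c i) * x ^ 3 := by
  simp only [ratioThree, Finset.sum_add_distrib, Finset.sum_sub_distrib, ← Finset.sum_mul,
    ← Finset.mul_sum, Finset.sum_const, nsmul_eq_mul]
  ring

lemma sum_ratioTwo : ∑ i ∈ T, ratioTwo x (a i) (b i) (c i) =
    T.card * (1 - 2 * x + 8 * x ^ 2 - 40 * x ^ 3 + 224 * x ^ 4) +
      (∑ i ∈ T, a i) * (9 * x ^ 3 - x ^ 2 - 66 * x ^ 4) +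
      (∑ i ∈ T, b i) * (x ^ 3 - 13 * x ^ 4) - (∑ i ∈ T, c i) * x ^ 4 := by
  simp only [ratioTwo, Finset.sum_add_distrib, Finset.sum_sub_distrib, ← Finset.sum_mul,
    ← Finset.mul_sum, Finset.sum_const, nsmul_eq_mul]
  ring

lemma sum_ratioOne : ∑ i ∈ T, ratioOne x (a i) (b i) (c i) =
    T.card * (1 - 2 * x + 8 * x ^ 2 - 40 * x ^ 3 + 224 * x ^ 4 - 1344 * x ^ 5) +
      (∑ i ∈ T, a i) * (x ^ 3 - 13 * x ^ 4 + 122 * x ^ 5) +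
      (∑ i ∈ T, b i) * (17 * x ^ 5 - x ^ 4) + (∑ i ∈ T, c i) * x ^ 5 := by
  simp only [ratioOne, Finset.sum_add_distrib, Finset.sum_sub_distrib, ← Finset.sum_mul,
    ← Finset.mul_sum, Finset.sum_const, nsmul_eq_mul]
  ring

lemma sum_ratioZero : ∑ i ∈ T, ratioZero x (a i) (b i) (c i) =
    T.card * (1 - 3 * x + 15 * x ^ 2 - 87 * x ^ 3 + 543 * x ^ 4 - 3543 * x ^ 5 + 23823 * x ^ 6) +
      (∑ i ∈ T, a i) * (19 * x ^ 5 - x ^ 4 - 239 * x ^ 6) +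
      (∑ i ∈ T, b i) * (x ^ 5 - 23 * x ^ 6) - (∑ i ∈ T, c i) * x ^ 6 := by
  simp only [ratioZero, Finset.sum_add_distrib, Finset.sum_sub_distrib, ← Finset.sum_mul,
    ← Finset.mul_sum, Finset.sum_const, nsmul_eq_mul]
  ring

end Sums

section Inverses

variable {x a b c : R}

lemma ratioFive_inverse : x ^ 2 ∣ (1 + x * (2 - a)) * ratioFive x a - 1 := by
  unfold ratioFive
  exact ⟨4 * a - a ^ 2 - 4, by ring⟩

lemma ratioFour_inverse (ha : a = 0 ∨ a = 1) :
    x ^ 3 ∣ (1 + x * ((2 - a) * (1 - 2 * x) + b * x)) * ratioFour x a b - 1 := by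
  unfold ratioFour
  rcases ha with rfl | rfl
  · exact ⟨12 * x * b - x * b ^ 2 - 32 * x - 4 * b + 24, by ring⟩
  · exact ⟨5 * x * b - x * b ^ 2 - 6 * x - 2 * b + 5, by ring⟩

lemma ratioThree_inverse (hab : a = 0 ∨ a = 1 ∧ b = 0) :
    x ^ 4 ∣ (1 + x * ((2 - a) * (1 - 2 * x + 8 * x ^ 2) + b * (x - 5 * x ^ 2) - c * x ^ 2)) *
      ratioThree x a b c - 1 := by
  unfold ratioThree
  rcases hab with rfl | ⟨rfl, rfl⟩
  · exact ⟨- 132 * x * b + 2 * x * b * c + 14 * x * b ^ 2 - 12 * x * c + 288 * x + 344 * x ^ 2 *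
    b - 14 * x ^ 2 * b * c - 45 * x ^ 2 * b ^ 2 + 56 * x ^ 2 * c - x ^ 2 * c ^ 2 - 640 * x
    ^ 2 + 40 * b - b ^ 2 + 4 * c - 144, by ring⟩
  · exact ⟨- 5 * x * c + 50 * x + 21 * x ^ 2 * c - x ^ 2 * c ^ 2 - 104 * x ^ 2 + 2 * c - 27,
      by ring⟩

lemma ratioTwo_inverse (ha : a = 0 ∨ a = 1) :
    x ^ 5 ∣ (1 + x * (2 * (1 - 2 * x + 8 * x ^ 2 - 40 * x ^ 3) +
      a * (x - 5 * x ^ 2 + 27 * x ^ 3) + b * (9 * x ^ 3 - x ^ 2) + c * x ^ 3)) *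
      ratioTwo x a b c - 1 := by
  unfold ratioTwo
  rcases ha with rfl | rfl
  · exact ⟨180 * x * b - x * b ^ 2 + 12 * x * c - 2176 * x - 872 * x ^ 2 * b + 2 * x ^ 2 * b * c
    + 22 * x ^ 2 * b ^ 2 - 56 * x ^ 2 * c + 6784 * x ^ 2 + 3056 * x ^ 3 * b - 22 * x ^ 3 *
    b * c - 117 * x ^ 3 * b ^ 2 + 304 * x ^ 3 * c - x ^ 3 * c ^ 2 - 17920 * x ^ 3 - 56 * b
    - 4 * c + 896, by ring⟩
  · exact ⟨144 * x * b - x * b ^ 2 + 10 * x * c - 1186 * x - 633 * x ^ 2 * b + 2 * x ^ 2 * b * c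
    + 22 * x ^ 2 * b ^ 2 - 42 * x ^ 2 * c + 3381 * x ^ 2 + 2111 * x ^ 3 * b - 22 * x ^ 3 *
    b * c - 117 * x ^ 3 * b ^ 2 + 211 * x ^ 3 * c - x ^ 3 * c ^ 2 - 8374 * x ^ 3 - 54 * b
    - 4 * c + 592, by ring⟩

lemma ratioOne_inverse :
    x ^ 6 ∣ (1 + x * (2 * (1 - 2 * x + 8 * x ^ 2 - 40 * x ^ 3 + 224 * x ^ 4) +
      a * (9 * x ^ 3 - x ^ 2 - 66 * x ^ 4) + b * (x ^ 3 - 13 * x ^ 4) - c * x ^ 4)) *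
      ratioOne x a b c - 1 := by
  unfold ratioOne
  exact ⟨- 1888 * x * a + 2 * x * a * b + 22 * x * a ^ 2 - 228 * x * b - 12 * x * c + 15744 * x
    + 9440 * x ^ 2 * a - 52 * x ^ 2 * a * b - 2 * x ^ 2 * a * c - 305 * x ^ 2 * a ^ 2 +
    1096 * x ^ 2 * b - x ^ 2 * b ^ 2 + 56 * x ^ 2 * c - 57344 * x ^ 2 - 42464 * x ^ 3 * a
    + 510 * x ^ 3 * a * b + 22 * x ^ 3 * a * c + 1956 * x ^ 3 * a ^ 2 - 6064 * x ^ 3 * b +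
    2 * x ^ 3 * b * c + 30 * x ^ 3 * b ^ 2 - 304 * x ^ 3 * c + 207872 * x ^ 3 + 143360 * x
    ^ 4 * a - 2708 * x ^ 4 * a * b - 188 * x ^ 4 * a * c - 8052 * x ^ 4 * a ^ 2 + 25088 *
    x ^ 4 * b - 30 * x ^ 4 * b * c - 221 * x ^ 4 * b ^ 2 + 1792 * x ^ 4 * c - x ^ 4 * c ^
    2 - 602112 * x ^ 4 + 556 * a - a ^ 2 + 72 * b + 4 * c - 5760, by ring⟩

lemma ratioZero_inverse :
    x ^ 7 ∣ (1 + x * (3 * (1 - 2 * x + 8 * x ^ 2 - 40 * x ^ 3 + 224 * x ^ 4 - 1344 * x ^ 5) +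
      a * (x ^ 3 - 13 * x ^ 4 + 122 * x ^ 5) + b * (17 * x ^ 5 - x ^ 4) + c * x ^ 5)) *
      ratioZero x a b c - 1 := by
  unfold ratioZero
  exact ⟨5514 * x * a - x * a ^ 2 + 504 * x * b + 21 * x * c - 412074 * x - 29904 * x ^ 2 * a +
    2 * x ^ 2 * a * b + 32 * x ^ 2 * a ^ 2 - 2694 * x ^ 2 * b - 111 * x ^ 2 * c + 1712592
    * x ^ 2 + 181608 * x ^ 3 * a - 72 * x ^ 3 * a * b - 2 * x ^ 3 * a * c - 608 * x ^ 3 *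
    a ^ 2 + 16206 * x ^ 3 * b - x ^ 3 * b ^ 2 + 663 * x ^ 3 * c - 7429032 * x ^ 3 - 979161
    * x ^ 4 * a + 983 * x ^ 4 * a * b + 32 * x ^ 4 * a * c + 5425 * x ^ 4 * a ^ 2 - 103542
    * x ^ 4 * b + 2 * x ^ 4 * b * c + 40 * x ^ 4 * b ^ 2 - 4215 * x ^ 4 * c + 30294432 * x
    ^ 4 + 3870054 * x ^ 5 * a - 6869 * x ^ 5 * a * b - 361 * x ^ 5 * a * c - 29158 * x ^ 5
    * a ^ 2 + 497727 * x ^ 5 * b - 40 * x ^ 5 * b * c - 391 * x ^ 5 * b ^ 2 + 27855 * x ^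
    5 * c - x ^ 5 * c ^ 2 - 96054336 * x ^ 5 - 1503 * a - 141 * b - 6 * c + 138375, by ring⟩

end Inverses

end TruncatedRatios

section LocalStructure

open scoped PowerSeries

variable {V : Type*} [Fintype V] [DecidableEq V]

/-- Cubic graphs, properly two-coloured by `c`, without a `K_{2,3}` subgraph. -/
structure IsSparseCubic (G : SimpleGraph V) [DecidableRel G.Adj] (c : V → Bool) : Prop where
  card_neighborFinset : ∀ v, (G.neighborFinset v).card = 3
  color_eq : ∀ {u v}, G.Adj u v → c v = !c u
  not_common : ∀ {a b x y z}, a ≠ b → x ≠ y → x ≠ z → y ≠ z → G.Adj a x → G.Adj a y →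
    G.Adj a z → G.Adj b x → G.Adj b y → G.Adj b z → False

/-- The indicator of adjacency, as a constant power series. -/
noncomputable def adjInd (G : SimpleGraph V) [DecidableRel G.Adj] (u v : V) : ℚ⟦X⟧ :=
  if G.Adj u v then 1 else 0

variable {G : SimpleGraph V} [DecidableRel G.Adj] {c : V → Bool}

namespace IsSparseCubic

lemma card_nextVertices (hG : IsSparseCubic G c) (S : Finset V) (v : V) :
    ((nextVertices G S v).card : ℚ⟦X⟧) = 3 - ∑ s ∈ S, adjInd G v s := by
  have h : G.neighborFinset v ∩ insert v S = S.filter (G.Adj v) := by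
    ext u
    simp only [Finset.mem_inter, mem_neighborFinset, Finset.mem_insert, Finset.mem_filter]
    exact ⟨fun h => ⟨h.2.resolve_left h.1.ne', h.1⟩, fun h => ⟨h.2, Or.inr h.1⟩⟩
  have h1 := Finset.card_sdiff_add_card_inter (G.neighborFinset v) (insert v S)
  rw [hG.card_neighborFinset, h] at h1
  simp only [adjInd]
  rw [Finset.sum_boole, eq_sub_iff_add_eq, nextVertices]
  exact_mod_cast congrArg (Nat.cast : ℕ → ℚ⟦X⟧) h1

variable {v₀ v₁ v₂ v₃ v₄ v₅ : V}

lemma card_next_zero (hG : IsSparseCubic G c) : ((nextVertices G ∅ v₀).card : ℚ⟦X⟧) = 3 := by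
  rw [hG.card_nextVertices]
  simp

lemma card_next_one (hG : IsSparseCubic G c) (h₁ : v₁ ∈ nextVertices G ∅ v₀) :
    ((nextVertices G {v₀} v₁).card : ℚ⟦X⟧) = 2 := by
  rw [hG.card_nextVertices]
  rw [mem_nextVertices] at h₁
  simp only [Finset.sum_singleton, adjInd, if_pos h₁.1.symm]
  norm_num

lemma card_next_two (hG : IsSparseCubic G c) (h₁ : v₁ ∈ nextVertices G ∅ v₀)
    (h₂ : v₂ ∈ nextVertices G {v₀} v₁) :
    ((nextVertices G {v₁, v₀} v₂).card : ℚ⟦X⟧) = 2 := by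
  rw [hG.card_nextVertices]
  simp only [mem_nextVertices, Finset.mem_singleton] at h₁ h₂
  have c₁ := hG.color_eq h₁.1
  have c₂ := hG.color_eq h₂.1
  have n₀ : ¬ G.Adj v₂ v₀ := fun h => by simpa [c₁, c₂] using hG.color_eq h
  rw [Finset.sum_insert (by simpa using h₁.1.ne')]
  simp only [Finset.sum_singleton, adjInd, if_pos h₂.1.symm, if_neg n₀]
  norm_num

lemma card_next_three (hG : IsSparseCubic G c) (h₁ : v₁ ∈ nextVertices G ∅ v₀)
    (h₂ : v₂ ∈ nextVertices G {v₀} v₁)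
    (h₃ : v₃ ∈ nextVertices G {v₁, v₀} v₂) :
    ((nextVertices G {v₂, v₁, v₀} v₃).card : ℚ⟦X⟧) = 2 - adjInd G v₃ v₀ := by
  rw [hG.card_nextVertices]
  simp only [mem_nextVertices, Finset.mem_insert, Finset.mem_singleton, not_or] at h₁ h₂ h₃
  have c₁ := hG.color_eq h₁.1
  have c₂ := hG.color_eq h₂.1
  have c₃ := hG.color_eq h₃.1
  have n₁ : ¬ G.Adj v₃ v₁ := fun h => by simpa [c₁, c₂, c₃] using hG.color_eq h
  rw [Finset.sum_insert (by simpa using ⟨h₂.1.ne', h₂.2⟩),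
    Finset.sum_insert (by simpa using h₁.1.ne')]
  simp only [Finset.sum_singleton, adjInd, if_pos h₃.1.symm, if_neg n₁]
  ring

lemma card_next_four (hG : IsSparseCubic G c) (h₁ : v₁ ∈ nextVertices G ∅ v₀)
    (h₂ : v₂ ∈ nextVertices G {v₀} v₁)
    (h₃ : v₃ ∈ nextVertices G {v₁, v₀} v₂) (h₄ : v₄ ∈ nextVertices G {v₂, v₁, v₀} v₃) :
    ((nextVertices G {v₃, v₂, v₁, v₀} v₄).card : ℚ⟦X⟧) = 2 - adjInd G v₄ v₁ := by
  rw [hG.card_nextVertices]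
  simp only [mem_nextVertices, Finset.mem_insert, Finset.mem_singleton, not_or] at h₁ h₂ h₃ h₄
  have c₁ := hG.color_eq h₁.1
  have c₂ := hG.color_eq h₂.1
  have c₃ := hG.color_eq h₃.1
  have c₄ := hG.color_eq h₄.1
  have n₀ : ¬ G.Adj v₄ v₀ := fun h => by simpa [c₁, c₂, c₃, c₄] using hG.color_eq h
  have n₂ : ¬ G.Adj v₄ v₂ := fun h => by simpa [c₁, c₂, c₃, c₄] using hG.color_eq h
  rw [Finset.sum_insert (by simpa using ⟨h₃.1.ne', h₃.2⟩),
    Finset.sum_insert (by simpa using ⟨h₂.1.ne', h₂.2⟩),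
    Finset.sum_insert (by simpa using h₁.1.ne')]
  simp only [Finset.sum_singleton, adjInd, if_pos h₄.1.symm, if_neg n₀, if_neg n₂]
  ring

lemma card_next_five (hG : IsSparseCubic G c) (h₁ : v₁ ∈ nextVertices G ∅ v₀)
    (h₂ : v₂ ∈ nextVertices G {v₀} v₁)
    (h₃ : v₃ ∈ nextVertices G {v₁, v₀} v₂) (h₄ : v₄ ∈ nextVertices G {v₂, v₁, v₀} v₃)
    (h₅ : v₅ ∈ nextVertices G {v₃, v₂, v₁, v₀} v₄) :
    ((nextVertices G {v₄, v₃, v₂, v₁, v₀} v₅).card : ℚ⟦X⟧) =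
      2 - (adjInd G v₅ v₂ + adjInd G v₅ v₀) := by
  rw [hG.card_nextVertices]
  simp only [mem_nextVertices, Finset.mem_insert, Finset.mem_singleton, not_or] at h₁ h₂ h₃ h₄ h₅
  have c₁ := hG.color_eq h₁.1
  have c₂ := hG.color_eq h₂.1
  have c₃ := hG.color_eq h₃.1
  have c₄ := hG.color_eq h₄.1
  have c₅ := hG.color_eq h₅.1
  have n₁ : ¬ G.Adj v₅ v₁ := fun h => by simpa [c₁, c₂, c₃, c₄, c₅] using hG.color_eq h
  have n₃ : ¬ G.Adj v₅ v₃ := fun h => by simpa [c₁, c₂, c₃, c₄, c₅] using hG.color_eq h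
  rw [Finset.sum_insert (by simpa using ⟨h₄.1.ne', h₄.2⟩),
    Finset.sum_insert (by simpa using ⟨h₃.1.ne', h₃.2⟩),
    Finset.sum_insert (by simpa using ⟨h₂.1.ne', h₂.2⟩),
    Finset.sum_insert (by simpa using h₁.1.ne')]
  simp only [Finset.sum_singleton, adjInd, if_pos h₅.1.symm, if_neg n₁, if_neg n₃]
  ring

lemma closing_three_or (hG : IsSparseCubic G c) (h₁ : v₁ ∈ nextVertices G ∅ v₀)
    (h₂ : v₂ ∈ nextVertices G {v₀} v₁)
    (h₃ : v₃ ∈ nextVertices G {v₁, v₀} v₂) :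
    adjInd G v₃ v₀ = 0 ∨ adjInd G v₃ v₀ = 1 ∧
      ∑ v₄ ∈ nextVertices G {v₂, v₁, v₀} v₃, adjInd G v₄ v₁ = 0 := by
  by_cases h : G.Adj v₃ v₀
  · refine Or.inr ⟨if_pos h, Finset.sum_eq_zero fun v₄ h₄ => if_neg fun h' => ?_⟩
    simp only [mem_nextVertices, Finset.mem_insert, Finset.mem_singleton, not_or] at h₁ h₂ h₃ h₄
    exact hG.not_common (a := v₁) (b := v₃) (x := v₀) (y := v₂) (z := v₄) (Ne.symm h₃.2.1)
      (Ne.symm h₂.2) (Ne.symm h₄.2.2.2) (Ne.symm h₄.2.1) h₁.1.symm h₂.1 h'.symm h h₃.1.symm h₄.1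
  · exact Or.inl (if_neg h)

lemma sum_closing_three_or (hG : IsSparseCubic G c) (h₁ : v₁ ∈ nextVertices G ∅ v₀)
    (h₂ : v₂ ∈ nextVertices G {v₀} v₁) :
    ∑ v₃ ∈ nextVertices G {v₁, v₀} v₂, adjInd G v₃ v₀ = 0 ∨
      ∑ v₃ ∈ nextVertices G {v₁, v₀} v₂, adjInd G v₃ v₀ = 1 := by
  simp only [adjInd]
  rw [Finset.sum_boole]
  have h : ((nextVertices G {v₁, v₀} v₂).filter fun v => G.Adj v v₀).card ≤ 1 := by
    rw [Finset.card_le_one]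
    intro a ha b hb
    by_contra hab
    simp only [Finset.mem_filter, mem_nextVertices, Finset.mem_insert, Finset.mem_singleton,
      not_or] at h₁ h₂ ha hb
    exact hG.not_common (a := v₀) (b := v₂) (x := v₁) (y := a) (z := b) (Ne.symm h₂.2)
      (Ne.symm ha.1.2.1) (Ne.symm hb.1.2.1) hab h₁.1 ha.2.symm hb.2.symm h₂.1.symm ha.1.1 hb.1.1
  rcases Nat.le_one_iff_eq_zero_or_eq_one.1 h with h | h <;> simp [h]

end IsSparseCubic

lemma notMem_insert_of_mem_next {S : Finset V} {u v : V} (h : v ∈ nextVertices G S u) :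
    v ∉ insert u S := by
  rw [nextVertices, Finset.mem_sdiff] at h
  exact h.2

lemma dvd_sum_matchingRatio {S : Finset V} {u : V} {k : ℕ} {p : V → ℚ⟦X⟧} {s : ℚ⟦X⟧}
    (hs : ∑ v ∈ nextVertices G S u, p v = s)
    (h : ∀ v ∈ nextVertices G S u,
      (PowerSeries.X : ℚ⟦X⟧) ^ k ∣ matchingRatio G (insert u S) v - p v) :
    (PowerSeries.X : ℚ⟦X⟧) ^ k ∣
      ∑ v ∈ nextVertices G S u, matchingRatio G (insert u S) v - s := by
  rw [← hs, ← Finset.sum_sub_distrib]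
  exact Finset.dvd_sum h

lemma X_dvd_matchingRatio_sub_one (S : Finset V) (v : V) :
    (PowerSeries.X : ℚ⟦X⟧) ^ 1 ∣ matchingRatio G S v - 1 := by
  rw [pow_one, PowerSeries.X_dvd_iff]
  simp [matchingRatio, constantCoeff_matchingSeries]

namespace IsSparseCubic

variable {v₀ v₁ v₂ v₃ v₄ v₅ : V}

lemma matchingRatio_five (hG : IsSparseCubic G c) (h₁ : v₁ ∈ nextVertices G ∅ v₀)
    (h₂ : v₂ ∈ nextVertices G {v₀} v₁)
    (h₃ : v₃ ∈ nextVertices G {v₁, v₀} v₂) (h₄ : v₄ ∈ nextVertices G {v₂, v₁, v₀} v₃)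
    (h₅ : v₅ ∈ nextVertices G {v₃, v₂, v₁, v₀} v₄) :
    PowerSeries.X ^ 2 ∣ matchingRatio G {v₄, v₃, v₂, v₁, v₀} v₅ -
      ratioFive PowerSeries.X (adjInd G v₅ v₂ + adjInd G v₅ v₀) := by
  refine pow_dvd_sub_of_mul_eq_one (matchingRatio_mul (notMem_insert_of_mem_next h₅))
    (dvd_sum_matchingRatio ?_ fun v _ => X_dvd_matchingRatio_sub_one _ v) ratioFive_inverse
  rw [Finset.sum_const, nsmul_one, hG.card_next_five h₁ h₂ h₃ h₄ h₅]

lemma matchingRatio_four (hG : IsSparseCubic G c) (h₁ : v₁ ∈ nextVertices G ∅ v₀)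
    (h₂ : v₂ ∈ nextVertices G {v₀} v₁)
    (h₃ : v₃ ∈ nextVertices G {v₁, v₀} v₂) (h₄ : v₄ ∈ nextVertices G {v₂, v₁, v₀} v₃) :
    PowerSeries.X ^ 3 ∣ matchingRatio G {v₃, v₂, v₁, v₀} v₄ -
      ratioFour PowerSeries.X (adjInd G v₄ v₁)
        (∑ v₅ ∈ nextVertices G {v₃, v₂, v₁, v₀} v₄, (adjInd G v₅ v₂ + adjInd G v₅ v₀)) := by
  refine pow_dvd_sub_of_mul_eq_one (matchingRatio_mul (notMem_insert_of_mem_next h₄))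
    (dvd_sum_matchingRatio ?_ fun v hv => hG.matchingRatio_five h₁ h₂ h₃ h₄ hv)
    (ratioFour_inverse ?_)
  · rw [sum_ratioFive, hG.card_next_four h₁ h₂ h₃ h₄]
  · by_cases h : G.Adj v₄ v₁
    · exact Or.inr (if_pos h)
    · exact Or.inl (if_neg h)

lemma matchingRatio_three (hG : IsSparseCubic G c) (h₁ : v₁ ∈ nextVertices G ∅ v₀)
    (h₂ : v₂ ∈ nextVertices G {v₀} v₁)
    (h₃ : v₃ ∈ nextVertices G {v₁, v₀} v₂) :
    PowerSeries.X ^ 4 ∣ matchingRatio G {v₂, v₁, v₀} v₃ -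
      ratioThree PowerSeries.X (adjInd G v₃ v₀)
        (∑ v₄ ∈ nextVertices G {v₂, v₁, v₀} v₃, adjInd G v₄ v₁)
        (∑ v₄ ∈ nextVertices G {v₂, v₁, v₀} v₃, ∑ v₅ ∈ nextVertices G {v₃, v₂, v₁, v₀} v₄,
          (adjInd G v₅ v₂ + adjInd G v₅ v₀)) := by
  refine pow_dvd_sub_of_mul_eq_one (matchingRatio_mul (notMem_insert_of_mem_next h₃))
    (dvd_sum_matchingRatio ?_ fun v hv => hG.matchingRatio_four h₁ h₂ h₃ hv)
    (ratioThree_inverse (hG.closing_three_or h₁ h₂ h₃))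
  rw [sum_ratioFour, hG.card_next_three h₁ h₂ h₃]

lemma matchingRatio_two (hG : IsSparseCubic G c) (h₁ : v₁ ∈ nextVertices G ∅ v₀)
    (h₂ : v₂ ∈ nextVertices G {v₀} v₁) :
    PowerSeries.X ^ 5 ∣ matchingRatio G {v₁, v₀} v₂ -
      ratioTwo PowerSeries.X
        (∑ v₃ ∈ nextVertices G {v₁, v₀} v₂, adjInd G v₃ v₀)
        (∑ v₃ ∈ nextVertices G {v₁, v₀} v₂, ∑ v₄ ∈ nextVertices G {v₂, v₁, v₀} v₃,
          adjInd G v₄ v₁)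
        (∑ v₃ ∈ nextVertices G {v₁, v₀} v₂, ∑ v₄ ∈ nextVertices G {v₂, v₁, v₀} v₃,
          ∑ v₅ ∈ nextVertices G {v₃, v₂, v₁, v₀} v₄, (adjInd G v₅ v₂ + adjInd G v₅ v₀)) := by
  refine pow_dvd_sub_of_mul_eq_one (matchingRatio_mul (notMem_insert_of_mem_next h₂))
    (dvd_sum_matchingRatio ?_ fun v hv => hG.matchingRatio_three h₁ h₂ hv)
    (ratioTwo_inverse (hG.sum_closing_three_or h₁ h₂))
  rw [sum_ratioThree, hG.card_next_two h₁ h₂]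

lemma matchingRatio_one (hG : IsSparseCubic G c) (h₁ : v₁ ∈ nextVertices G ∅ v₀) :
    PowerSeries.X ^ 6 ∣ matchingRatio G {v₀} v₁ -
      ratioOne PowerSeries.X
        (∑ v₂ ∈ nextVertices G {v₀} v₁, ∑ v₃ ∈ nextVertices G {v₁, v₀} v₂, adjInd G v₃ v₀)
        (∑ v₂ ∈ nextVertices G {v₀} v₁, ∑ v₃ ∈ nextVertices G {v₁, v₀} v₂,
          ∑ v₄ ∈ nextVertices G {v₂, v₁, v₀} v₃, adjInd G v₄ v₁)
        (∑ v₂ ∈ nextVertices G {v₀} v₁, ∑ v₃ ∈ nextVertices G {v₁, v₀} v₂,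
          ∑ v₄ ∈ nextVertices G {v₂, v₁, v₀} v₃, ∑ v₅ ∈ nextVertices G {v₃, v₂, v₁, v₀} v₄,
            (adjInd G v₅ v₂ + adjInd G v₅ v₀)) := by
  refine pow_dvd_sub_of_mul_eq_one
    (matchingRatio_mul (by simpa using notMem_insert_of_mem_next h₁))
    (dvd_sum_matchingRatio ?_ fun v hv => hG.matchingRatio_two h₁ hv) ratioOne_inverse
  rw [sum_ratioTwo, hG.card_next_one h₁]

lemma matchingRatio_zero (hG : IsSparseCubic G c) (v₀ : V) :
    PowerSeries.X ^ 7 ∣ matchingRatio G ∅ v₀ -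
      ratioZero PowerSeries.X
        (∑ v₁ ∈ nextVertices G ∅ v₀, ∑ v₂ ∈ nextVertices G {v₀} v₁,
          ∑ v₃ ∈ nextVertices G {v₁, v₀} v₂, adjInd G v₃ v₀)
        (∑ v₁ ∈ nextVertices G ∅ v₀, ∑ v₂ ∈ nextVertices G {v₀} v₁,
          ∑ v₃ ∈ nextVertices G {v₁, v₀} v₂, ∑ v₄ ∈ nextVertices G {v₂, v₁, v₀} v₃,
            adjInd G v₄ v₁)
        (∑ v₁ ∈ nextVertices G ∅ v₀, ∑ v₂ ∈ nextVertices G {v₀} v₁,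
          ∑ v₃ ∈ nextVertices G {v₁, v₀} v₂, ∑ v₄ ∈ nextVertices G {v₂, v₁, v₀} v₃,
            ∑ v₅ ∈ nextVertices G {v₃, v₂, v₁, v₀} v₄, (adjInd G v₅ v₂ + adjInd G v₅ v₀)) := by
  refine pow_dvd_sub_of_mul_eq_one (matchingRatio_mul (Finset.notMem_empty v₀))
    (dvd_sum_matchingRatio (p := fun v₁ => ratioOne PowerSeries.X
      (∑ v₂ ∈ nextVertices G {v₀} v₁, ∑ v₃ ∈ nextVertices G {v₁, v₀} v₂, adjInd G v₃ v₀)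
      (∑ v₂ ∈ nextVertices G {v₀} v₁, ∑ v₃ ∈ nextVertices G {v₁, v₀} v₂,
        ∑ v₄ ∈ nextVertices G {v₂, v₁, v₀} v₃, adjInd G v₄ v₁)
      (∑ v₂ ∈ nextVertices G {v₀} v₁, ∑ v₃ ∈ nextVertices G {v₁, v₀} v₂,
        ∑ v₄ ∈ nextVertices G {v₂, v₁, v₀} v₃, ∑ v₅ ∈ nextVertices G {v₃, v₂, v₁, v₀} v₄,
          (adjInd G v₅ v₂ + adjInd G v₅ v₀))) ?_
      fun v hv => by simpa using hG.matchingRatio_one hv) ratioZero_inverse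
  rw [sum_ratioOne, hG.card_next_zero]

end IsSparseCubic

end LocalStructure

section PathSums

open scoped PowerSeries

variable {V : Type*} [Fintype V] [DecidableEq V]

/-- The number of sequences of four vertices that trace out a 4-cycle of `G`. -/
def closedFourCount (G : SimpleGraph V) [DecidableRel G.Adj] : ℕ :=
  ∑ a, ∑ b, ∑ c, ∑ d, if G.Adj a b ∧ G.Adj b c ∧ G.Adj c d ∧ G.Adj d a ∧ a ≠ c ∧ b ≠ d
    then 1 else 0

/-- The number of sequences of six vertices that trace out a 6-cycle of `G`. -/
def closedSixCount (G : SimpleGraph V) [DecidableRel G.Adj] : ℕ :=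
  ∑ a, ∑ b, ∑ c, ∑ d, ∑ e, ∑ f,
    if G.Adj a b ∧ G.Adj b c ∧ G.Adj c d ∧ G.Adj d e ∧ G.Adj e f ∧ G.Adj f a ∧ a ≠ c ∧ a ≠ d ∧
      a ≠ e ∧ b ≠ d ∧ b ≠ e ∧ b ≠ f ∧ c ≠ e ∧ c ≠ f ∧ d ≠ f then 1 else 0

lemma sum_rev_five {V M : Type*} [Fintype V] [AddCommMonoid M] (g : V → V → V → V → V → M) :
    ∑ a, ∑ b, ∑ c, ∑ d, ∑ e, g a b c d e = ∑ a, ∑ b, ∑ c, ∑ d, ∑ e, g e d c b a := by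
  have h2 (f : V → V → M) : ∑ a, ∑ b, f a b = ∑ b, ∑ a, f a b := Finset.sum_comm
  have h3 (f : V → V → V → M) : ∑ a, ∑ b, ∑ c, f a b c = ∑ b, ∑ c, ∑ a, f a b c := by
    rw [Finset.sum_comm]; exact Finset.sum_congr rfl fun b _ => h2 _
  have h4 (f : V → V → V → V → M) :
      ∑ a, ∑ b, ∑ c, ∑ d, f a b c d = ∑ b, ∑ c, ∑ d, ∑ a, f a b c d := by
    rw [Finset.sum_comm]; exact Finset.sum_congr rfl fun b _ => h3 _
  have h5 (f : V → V → V → V → V → M) :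
      ∑ a, ∑ b, ∑ c, ∑ d, ∑ e, f a b c d e = ∑ b, ∑ c, ∑ d, ∑ e, ∑ a, f a b c d e := by
    rw [Finset.sum_comm]; exact Finset.sum_congr rfl fun b _ => h4 _
  rw [h5, h4 (fun b c d e => ∑ a, g a b c d e), h3 (fun c d e => ∑ b, ∑ a, g a b c d e),
    h2 (fun d e => ∑ c, ∑ b, ∑ a, g a b c d e)]

lemma sum_rev_six {V M : Type*} [Fintype V] [AddCommMonoid M] (g : V → V → V → V → V → V → M) :
    ∑ a, ∑ b, ∑ c, ∑ d, ∑ e, ∑ f, g a b c d e f =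
      ∑ a, ∑ b, ∑ c, ∑ d, ∑ e, ∑ f, g f e d c b a := by
  have h2 (f : V → V → M) : ∑ a, ∑ b, f a b = ∑ b, ∑ a, f a b := Finset.sum_comm
  have h3 (f : V → V → V → M) : ∑ a, ∑ b, ∑ c, f a b c = ∑ b, ∑ c, ∑ a, f a b c := by
    rw [Finset.sum_comm]; exact Finset.sum_congr rfl fun b _ => h2 _
  have h4 (f : V → V → V → V → M) :
      ∑ a, ∑ b, ∑ c, ∑ d, f a b c d = ∑ b, ∑ c, ∑ d, ∑ a, f a b c d := by
    rw [Finset.sum_comm]; exact Finset.sum_congr rfl fun b _ => h3 _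
  have h5 (f : V → V → V → V → V → M) :
      ∑ a, ∑ b, ∑ c, ∑ d, ∑ e, f a b c d e = ∑ b, ∑ c, ∑ d, ∑ e, ∑ a, f a b c d e := by
    rw [Finset.sum_comm]; exact Finset.sum_congr rfl fun b _ => h4 _
  have h6 (k : V → V → V → V → V → V → M) :
      ∑ a, ∑ b, ∑ c, ∑ d, ∑ e, ∑ f, k a b c d e f =
        ∑ b, ∑ c, ∑ d, ∑ e, ∑ f, ∑ a, k a b c d e f := by
    rw [Finset.sum_comm]; exact Finset.sum_congr rfl fun b _ => h5 _
  rw [h6, sum_rev_five]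

variable {G : SimpleGraph V} [DecidableRel G.Adj] {c : V → Bool}

lemma sum_nextVertices {M : Type*} [AddCommMonoid M] (S : Finset V) (u : V) (f : V → M) :
    ∑ v ∈ nextVertices G S u, f v = ∑ v, if v ∈ nextVertices G S u then f v else 0 := by
  simp

lemma ite_sum_zero {V M : Type*} [Fintype V] [AddCommMonoid M] (p : Prop) [Decidable p]
    (f : V → M) :
    (if p then ∑ v, f v else 0) = ∑ v, if p then f v else 0 := by
  split_ifs <;> simp

/-- A path on five vertices may be summed over starting from its other end. -/
lemma sum_path_five_rev :
    ∑ v₀, ∑ v₁ ∈ nextVertices G ∅ v₀, ∑ v₂ ∈ nextVertices G {v₀} v₁,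
      ∑ v₃ ∈ nextVertices G {v₁, v₀} v₂, ∑ v₄ ∈ nextVertices G {v₂, v₁, v₀} v₃, adjInd G v₄ v₁ =
    ∑ v₀, ∑ v₁ ∈ nextVertices G ∅ v₀, ∑ v₂ ∈ nextVertices G {v₀} v₁,
      ∑ v₃ ∈ nextVertices G {v₁, v₀} v₂, ∑ _ ∈ nextVertices G {v₂, v₁, v₀} v₃,
        adjInd G v₃ v₀ := by
  simp only [sum_nextVertices, ite_sum_zero, ← ite_and]
  rw [sum_rev_five]
  refine Finset.sum_congr rfl fun a _ => Finset.sum_congr rfl fun b _ =>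
    Finset.sum_congr rfl fun c _ => Finset.sum_congr rfl fun d _ => Finset.sum_congr rfl fun e _ =>
    ?_
  have hs : adjInd G a d = adjInd G d a := by simp only [adjInd, G.adj_comm]
  rw [hs]
  refine if_congr ?_ rfl rfl
  simp only [mem_nextVertices, Finset.mem_insert, Finset.mem_singleton, not_or,
    Finset.notMem_empty, not_false_eq_true, and_true]
  have := G.adj_comm a b
  have := G.adj_comm b c
  have := G.adj_comm c d
  have := G.adj_comm d e
  grind

/-- A path on six vertices may be summed over starting from its other end. -/
lemma sum_path_six_rev :
    ∑ v₀, ∑ v₁ ∈ nextVertices G ∅ v₀, ∑ v₂ ∈ nextVertices G {v₀} v₁,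
      ∑ v₃ ∈ nextVertices G {v₁, v₀} v₂, ∑ v₄ ∈ nextVertices G {v₂, v₁, v₀} v₃,
        ∑ v₅ ∈ nextVertices G {v₃, v₂, v₁, v₀} v₄, adjInd G v₅ v₂ =
    ∑ v₀, ∑ v₁ ∈ nextVertices G ∅ v₀, ∑ v₂ ∈ nextVertices G {v₀} v₁,
      ∑ v₃ ∈ nextVertices G {v₁, v₀} v₂, ∑ v₄ ∈ nextVertices G {v₂, v₁, v₀} v₃,
        ∑ _ ∈ nextVertices G {v₃, v₂, v₁, v₀} v₄, adjInd G v₃ v₀ := by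
  simp only [sum_nextVertices, ite_sum_zero, ← ite_and]
  rw [sum_rev_six]
  refine Finset.sum_congr rfl fun a _ => Finset.sum_congr rfl fun b _ =>
    Finset.sum_congr rfl fun c _ => Finset.sum_congr rfl fun d _ => Finset.sum_congr rfl fun e _ =>
    Finset.sum_congr rfl fun f _ => ?_
  have hs : adjInd G a d = adjInd G d a := by simp only [adjInd, G.adj_comm]
  rw [hs]
  refine if_congr ?_ rfl rfl
  simp only [mem_nextVertices, Finset.mem_insert, Finset.mem_singleton, not_or,
    Finset.notMem_empty, not_false_eq_true, and_true]
  have := G.adj_comm a b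
  have := G.adj_comm b c
  have := G.adj_comm c d
  have := G.adj_comm d e
  have := G.adj_comm e f
  grind

lemma sum_closing_three :
    ∑ v₀, ∑ v₁ ∈ nextVertices G ∅ v₀, ∑ v₂ ∈ nextVertices G {v₀} v₁,
      ∑ v₃ ∈ nextVertices G {v₁, v₀} v₂, adjInd G v₃ v₀ = (closedFourCount G : ℚ⟦X⟧) := by
  simp only [sum_nextVertices, ite_sum_zero, ← ite_and, adjInd, closedFourCount, Nat.cast_sum,
    Nat.cast_ite, Nat.cast_one, Nat.cast_zero]
  refine Finset.sum_congr rfl fun a _ => Finset.sum_congr rfl fun b _ =>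
    Finset.sum_congr rfl fun c _ => Finset.sum_congr rfl fun d _ => if_congr ?_ rfl rfl
  simp only [mem_nextVertices, Finset.mem_insert, Finset.mem_singleton, not_or,
    Finset.notMem_empty, not_false_eq_true, and_true]
  have := @SimpleGraph.Adj.ne' _ G d a
  grind

lemma sum_closing_five :
    ∑ v₀, ∑ v₁ ∈ nextVertices G ∅ v₀, ∑ v₂ ∈ nextVertices G {v₀} v₁,
      ∑ v₃ ∈ nextVertices G {v₁, v₀} v₂, ∑ v₄ ∈ nextVertices G {v₂, v₁, v₀} v₃,
        ∑ v₅ ∈ nextVertices G {v₃, v₂, v₁, v₀} v₄, adjInd G v₅ v₀ =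
      (closedSixCount G : ℚ⟦X⟧) := by
  simp only [sum_nextVertices, ite_sum_zero, ← ite_and, adjInd, closedSixCount, Nat.cast_sum,
    Nat.cast_ite, Nat.cast_one, Nat.cast_zero]
  refine Finset.sum_congr rfl fun a _ => Finset.sum_congr rfl fun b _ =>
    Finset.sum_congr rfl fun c _ => Finset.sum_congr rfl fun d _ => Finset.sum_congr rfl fun e _ =>
    Finset.sum_congr rfl fun f _ => if_congr ?_ rfl rfl
  simp only [mem_nextVertices, Finset.mem_insert, Finset.mem_singleton, not_or,
    Finset.notMem_empty, not_false_eq_true, and_true]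
  have := @SimpleGraph.Adj.ne' _ G f a
  grind

namespace IsSparseCubic

lemma sum_closing_four (hG : IsSparseCubic G c) :
    ∑ v₀, ∑ v₁ ∈ nextVertices G ∅ v₀, ∑ v₂ ∈ nextVertices G {v₀} v₁,
      ∑ v₃ ∈ nextVertices G {v₁, v₀} v₂, ∑ v₄ ∈ nextVertices G {v₂, v₁, v₀} v₃, adjInd G v₄ v₁ =
      (closedFourCount G : ℚ⟦X⟧) := by
  rw [sum_path_five_rev, ← sum_closing_three]
  refine Finset.sum_congr rfl fun v₀ _ => Finset.sum_congr rfl fun v₁ h₁ =>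
    Finset.sum_congr rfl fun v₂ h₂ => Finset.sum_congr rfl fun v₃ h₃ => ?_
  rw [Finset.sum_const, nsmul_eq_mul, hG.card_next_three h₁ h₂ h₃]
  rcases hG.closing_three_or h₁ h₂ h₃ with h | ⟨h, -⟩ <;> rw [h] <;> ring

lemma sum_closing_five_inner (hG : IsSparseCubic G c) :
    ∑ v₀, ∑ v₁ ∈ nextVertices G ∅ v₀, ∑ v₂ ∈ nextVertices G {v₀} v₁,
      ∑ v₃ ∈ nextVertices G {v₁, v₀} v₂, ∑ v₄ ∈ nextVertices G {v₂, v₁, v₀} v₃,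
        ∑ v₅ ∈ nextVertices G {v₃, v₂, v₁, v₀} v₄, adjInd G v₅ v₂ =
      2 * (closedFourCount G : ℚ⟦X⟧) := by
  rw [sum_path_six_rev, ← sum_closing_three]
  simp only [Finset.mul_sum]
  refine Finset.sum_congr rfl fun v₀ _ => Finset.sum_congr rfl fun v₁ h₁ =>
    Finset.sum_congr rfl fun v₂ h₂ => Finset.sum_congr rfl fun v₃ h₃ => ?_
  have h : ∀ v₄ ∈ nextVertices G {v₂, v₁, v₀} v₃,
      ∑ v₅ ∈ nextVertices G {v₃, v₂, v₁, v₀} v₄, adjInd G v₃ v₀ =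
        (2 - adjInd G v₄ v₁) * adjInd G v₃ v₀ := fun v₄ h₄ => by
    rw [Finset.sum_const, nsmul_eq_mul, hG.card_next_four h₁ h₂ h₃ h₄]
  rw [Finset.sum_congr rfl h, ← Finset.sum_mul, Finset.sum_sub_distrib, Finset.sum_const,
    nsmul_eq_mul, hG.card_next_three h₁ h₂ h₃]
  rcases hG.closing_three_or h₁ h₂ h₃ with h | ⟨h, h'⟩
  · rw [h]; ring
  · rw [h, h']; ring

lemma sum_matchingRatio (hG : IsSparseCubic G c) :
    PowerSeries.X ^ 7 ∣ ∑ v, matchingRatio G ∅ v -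
      ((Fintype.card V : ℚ⟦X⟧) * (1 - 3 * PowerSeries.X + 15 * PowerSeries.X ^ 2 -
          87 * PowerSeries.X ^ 3 + 543 * PowerSeries.X ^ 4 - 3543 * PowerSeries.X ^ 5 +
          23823 * PowerSeries.X ^ 6) +
        (closedFourCount G : ℚ⟦X⟧) * (20 * PowerSeries.X ^ 5 - PowerSeries.X ^ 4 -
          264 * PowerSeries.X ^ 6) -
        (closedSixCount G : ℚ⟦X⟧) * PowerSeries.X ^ 6) := by
  have h := Finset.dvd_sum fun v (_ : v ∈ Finset.univ) => hG.matchingRatio_zero v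
  rw [Finset.sum_sub_distrib, sum_ratioZero, sum_closing_three, hG.sum_closing_four] at h
  simp only [Finset.sum_add_distrib] at h
  rw [hG.sum_closing_five_inner, sum_closing_five, Finset.card_univ] at h
  convert h using 2
  ring

end IsSparseCubic

/-- The coefficients below degree `7` of a power series given modulo `X ^ 7`. -/
lemma coeff_sum_C_mul_X_pow_sub {R : Type*} [CommRing R] (s₁ s₂ s₃ s₄ s₅ s₆ : R) (q : R⟦X⟧)
    {k : ℕ} (hk : k < 7) :
    PowerSeries.coeff k (PowerSeries.C s₁ * PowerSeries.X ^ 1 +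
      PowerSeries.C s₂ * PowerSeries.X ^ 2 +
      PowerSeries.C s₃ * PowerSeries.X ^ 3 + PowerSeries.C s₄ * PowerSeries.X ^ 4 +
      PowerSeries.C s₅ * PowerSeries.X ^ 5 + PowerSeries.C s₆ * PowerSeries.X ^ 6 -
      q * PowerSeries.X ^ 7) =
      if k = 1 then s₁ else if k = 2 then s₂ else if k = 3 then s₃ else if k = 4 then s₄
      else if k = 5 then s₅ else if k = 6 then s₆ else 0 := by
  rw [map_sub, PowerSeries.coeff_mul_X_pow', if_neg (by omega)]
  simp only [map_add, PowerSeries.coeff_C_mul_X_pow]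
  interval_cases k <;> norm_num

/-- The number of 6-matchings in terms of the numbers of vertices, 4-cycles and 6-cycles. -/
lemma IsSparseCubic.coeff_six_matchingSeries (hG : IsSparseCubic G c) {h y : ℕ}
    (hcard : Fintype.card V = 2 * h + 8) (h4 : closedFourCount G = 48)
    (h6 : closedSixCount G = 12 * (h + y)) :
    240 * PowerSeries.coeff 6 (matchingSeries G ∅) =
      243 * (h : ℚ) ^ 6 - 243 * h ^ 5 - 1485 * h ^ 4 + 6075 * h ^ 3 - 11238 * h ^ 2 + 9768 * h -
        3840 + 240 * y := by
  set S := ∑ v, (1 - matchingRatio G ∅ v) with hS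
  obtain ⟨q, hq⟩ := hG.sum_matchingRatio
  have hS' : S = PowerSeries.C (6 * h + 24 : ℚ) * PowerSeries.X ^ 1 +
      PowerSeries.C (-30 * h - 120 : ℚ) * PowerSeries.X ^ 2 +
      PowerSeries.C (174 * h + 696 : ℚ) * PowerSeries.X ^ 3 +
      PowerSeries.C (-1086 * h - 4296 : ℚ) * PowerSeries.X ^ 4 +
      PowerSeries.C (7086 * h + 27384 : ℚ) * PowerSeries.X ^ 5 +
      PowerSeries.C (-47634 * h + 12 * y - 177912 : ℚ) * PowerSeries.X ^ 6 -
      q * PowerSeries.X ^ 7 := by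
    rw [hS, Finset.sum_sub_distrib, Finset.sum_const, nsmul_one, Finset.card_univ,
      sub_eq_iff_eq_add.1 hq, hcard, h4, h6]
    simp only [map_add, map_sub, map_neg, map_mul, map_natCast, map_ofNat]
    push_cast
    ring
  have hc (k : ℕ) (hk : k < 7) : PowerSeries.coeff k S =
      if k = 1 then (6 * h + 24 : ℚ) else if k = 2 then (-30 * h - 120 : ℚ)
      else if k = 3 then (174 * h + 696 : ℚ) else if k = 4 then (-1086 * h - 4296 : ℚ)
      else if k = 5 then (7086 * h + 27384 : ℚ)
      else if k = 6 then (-47634 * h + 12 * y - 177912 : ℚ) else 0 := by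
    rw [hS', coeff_sum_C_mul_X_pow_sub _ _ _ _ _ _ _ hk]
  have h0 : PowerSeries.coeff 0 (matchingSeries G ∅) = 1 := by
    rw [PowerSeries.coeff_zero_eq_constantCoeff_apply, constantCoeff_matchingSeries]
  have hrec (k : ℕ) := two_mul_coeff_matchingSeries (G := G) k
  simp only [← hS, PowerSeries.coeff_mul, Finset.Nat.sum_antidiagonal_eq_sum_range_succ_mk] at hrec
  have r1 := hrec 1
  have r2 := hrec 2
  have r3 := hrec 3
  have r4 := hrec 4
  have r5 := hrec 5
  have r6 := hrec 6
  simp only [Finset.sum_range_succ, Finset.sum_range_zero, Nat.reduceSub,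
    hc 0 (by norm_num), hc 1 (by norm_num), hc 2 (by norm_num), hc 3 (by norm_num),
    hc 4 (by norm_num), hc 5 (by norm_num), hc 6 (by norm_num), h0] at r1 r2 r3 r4 r5 r6
  norm_num at r1 r2 r3 r4 r5 r6
  generalize PowerSeries.coeff 1 (matchingSeries G ∅) = m1 at *
  generalize PowerSeries.coeff 2 (matchingSeries G ∅) = m2 at *
  generalize PowerSeries.coeff 3 (matchingSeries G ∅) = m3 at *
  generalize PowerSeries.coeff 4 (matchingSeries G ∅) = m4 at *
  generalize PowerSeries.coeff 5 (matchingSeries G ∅) = m5 at *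
  generalize PowerSeries.coeff 6 (matchingSeries G ∅) = m6 at *
  obtain rfl : m1 = 3 * h + 12 := by linarith
  obtain rfl : m2 = 9 / 2 * h ^ 2 + 57 / 2 * h + 42 := by linarith
  obtain rfl : m3 = 9 / 2 * h ^ 3 + 63 / 2 * h ^ 2 + 65 * h + 44 := by linarith
  obtain rfl : m4 = 27 / 8 * h ^ 4 + 81 / 4 * h ^ 3 + 273 / 8 * h ^ 2 + 117 / 4 * h + 9 := by
    linarith
  obtain rfl : m5 = 81 / 40 * h ^ 5 + 27 / 4 * h ^ 4 - 9 / 8 * h ^ 3 + 39 / 4 * h ^ 2 -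
      27 / 5 * h := by
    linarith
  linarith

end PathSums

section CopyCount

variable {V W : Type*}

/-- The copies of `X` with a given image are the isomorphisms from `X` to that image. -/
noncomputable def sigmaIsoEquivCopy (G : SimpleGraph V) (X : SimpleGraph W) :
    (Σ H : {H : G.Subgraph // Nonempty (H.coe ≃g X)}, X ≃g H.1.coe) ≃ Copy X G :=
  Equiv.ofBijective (fun p => p.1.1.coeCopy.comp p.2.toCopy) <| by
    have key (p : Σ H : {H : G.Subgraph // Nonempty (H.coe ≃g X)}, X ≃g H.1.coe) :
        (p.1.1.coeCopy.comp p.2.toCopy).toSubgraph = p.1.1 := by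
      obtain ⟨⟨H, hH⟩, φ⟩ := p
      ext u v
      · simp only [Copy.toSubgraph, Subgraph.map_verts, Subgraph.verts_top, Set.image_univ,
          Set.mem_range]
        constructor
        · rintro ⟨x, rfl⟩
          exact (φ x).2
        · exact fun hu => ⟨φ.symm ⟨u, hu⟩, congrArg Subtype.val (φ.apply_symm_apply _)⟩
      · simp only [Copy.toSubgraph, Subgraph.map_adj, Subgraph.top_adj, Relation.Map]
        constructor
        · rintro ⟨a, b, hab, rfl, rfl⟩
          exact φ.map_adj_iff.2 hab
        · intro h
          refine ⟨φ.symm ⟨u, h.fst_mem⟩, φ.symm ⟨v, h.snd_mem⟩, φ.symm.map_adj_iff.2 h,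
            congrArg Subtype.val (φ.apply_symm_apply _),
            congrArg Subtype.val (φ.apply_symm_apply _)⟩
    constructor
    · rintro ⟨⟨H, hH⟩, φ⟩ ⟨⟨K, hK⟩, ψ⟩ h
      have hHK : H = K := (key ⟨⟨H, hH⟩, φ⟩).symm.trans
        ((congrArg Copy.toSubgraph h).trans (key ⟨⟨K, hK⟩, ψ⟩))
      subst hHK
      have : φ = ψ := by
        ext x
        exact DFunLike.congr_fun h x
      rw [this]
    · intro f
      exact ⟨⟨⟨f.toSubgraph, ⟨f.isoToSubgraph.symm⟩⟩, f.isoToSubgraph⟩, by ext x; rfl⟩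

lemma card_copy_eq_numSubgraphs_mul [Finite V] [Finite W] (G : SimpleGraph V)
    (X : SimpleGraph W) : Nat.card (Copy X G) = numSubgraphs G X * Nat.card (X ≃g X) := by
  have : Fintype {H : G.Subgraph // Nonempty (H.coe ≃g X)} := Fintype.ofFinite _
  have (H : {H : G.Subgraph // Nonempty (H.coe ≃g X)}) : Finite (X ≃g H.1.coe) :=
    DFunLike.finite _
  rw [← Nat.card_congr (sigmaIsoEquivCopy G X), Nat.card_sigma,
    Finset.sum_congr rfl fun H _ => Nat.card_congr (β := X ≃g X)
      ⟨fun e => e.trans H.2.some, fun e => e.trans H.2.some.symm, fun e => by ext; simp,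
        fun e => by ext; simp⟩,
    Finset.sum_const, smul_eq_mul, Finset.card_univ, ← Nat.card_eq_fintype_card]
  rfl

/-- A copy of a finite graph in itself is an automorphism. -/
lemma card_iso_eq_card_copy [Finite W] (X : SimpleGraph W) :
    Nat.card (X ≃g X) = Nat.card (Copy X X) := by
  refine Nat.card_congr (Equiv.ofBijective (fun e => e.toCopy) ⟨fun e f h => ?_, fun f => ?_⟩)
  · ext x
    exact DFunLike.congr_fun h x
  · have hf : Function.Bijective f := Finite.injective_iff_bijective.1 f.injective
    have he := Finite.surjective_of_injective f.mapEdgeSet.injective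
    refine ⟨⟨Equiv.ofBijective f hf, fun {a b} => ⟨fun h => ?_, fun h => f.toHom.map_adj h⟩⟩, ?_⟩
    · obtain ⟨⟨e, hab⟩, h⟩ := he ⟨s(f a, f b), h⟩
      have h' : Sym2.map f e = Sym2.map f s(a, b) := congrArg Subtype.val h
      rw [Sym2.map.injective f.injective h'] at hab
      exact hab
    · ext x
      rfl

end CopyCount

section Cycles

variable {V : Type*} [Fintype V] [DecidableEq V]

/-- The copy of the 4-cycle that visits four given vertices. -/
def fourCycleCopy {V : Type*} {G : SimpleGraph V} {a b c d : V} (hab : G.Adj a b) (hbc : G.Adj b c)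
    (hcd : G.Adj c d) (hda : G.Adj d a) (hac : a ≠ c) (hbd : b ≠ d) : Copy (cycleGraph 4) G where
  toHom.toFun := ![a, b, c, d]
  toHom.map_rel' := by
    intro u v huv
    fin_cases u <;> fin_cases v <;>
      first
      | exact hab
      | exact hab.symm
      | exact hbc
      | exact hbc.symm
      | exact hcd
      | exact hcd.symm
      | exact hda
      | exact hda.symm
      | exact absurd huv (by decide)
  injective' := by
    have := hab.ne
    have := hbc.ne
    have := hcd.ne
    have := hda.ne
    intro u v huv
    fin_cases u <;> fin_cases v <;>
      first
      | rfl
      | exact absurd huv (by assumption)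
      | exact absurd huv (Ne.symm (by assumption))

/-- The copy of the 6-cycle that visits six given vertices. -/
def sixCycleCopy {V : Type*} {G : SimpleGraph V} {a b c d e f : V} (hab : G.Adj a b)
    (hbc : G.Adj b c) (hcd : G.Adj c d) (hde : G.Adj d e) (hef : G.Adj e f) (hfa : G.Adj f a)
    (hac : a ≠ c) (had : a ≠ d) (hae : a ≠ e) (hbd : b ≠ d) (hbe : b ≠ e) (hbf : b ≠ f)
    (hce : c ≠ e) (hcf : c ≠ f) (hdf : d ≠ f) : Copy (cycleGraph 6) G where
  toHom.toFun := ![a, b, c, d, e, f]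
  toHom.map_rel' := by
    intro u v huv
    fin_cases u <;> fin_cases v <;>
      first
      | exact hab
      | exact hab.symm
      | exact hbc
      | exact hbc.symm
      | exact hcd
      | exact hcd.symm
      | exact hde
      | exact hde.symm
      | exact hef
      | exact hef.symm
      | exact hfa
      | exact hfa.symm
      | exact absurd huv (by decide)
  injective' := by
    have := hab.ne
    have := hbc.ne
    have := hcd.ne
    have := hde.ne
    have := hef.ne
    have := hfa.ne
    intro u v huv
    fin_cases u <;> fin_cases v <;>
      first
      | rfl
      | exact absurd huv (by assumption)
      | exact absurd huv (Ne.symm (by assumption))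

lemma card_copy_cycleGraph_four (G : SimpleGraph V) [DecidableRel G.Adj] :
    Nat.card (Copy (cycleGraph 4) G) = closedFourCount G := by
  let e : Copy (cycleGraph 4) G ≃ {p : V × V × V × V // G.Adj p.1 p.2.1 ∧ G.Adj p.2.1 p.2.2.1 ∧
      G.Adj p.2.2.1 p.2.2.2 ∧ G.Adj p.2.2.2 p.1 ∧ p.1 ≠ p.2.2.1 ∧ p.2.1 ≠ p.2.2.2} :=
    { toFun f := ⟨(f 0, f 1, f 2, f 3), by
        have hf (i j : Fin 4) (h : (cycleGraph 4).Adj i j) : G.Adj (f i) (f j) := f.toHom.map_adj h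
        have hi (i j : Fin 4) (h : i ≠ j) : f i ≠ f j := f.injective.ne h
        refine ⟨hf _ _ ?_, hf _ _ ?_, hf _ _ ?_, hf _ _ ?_, hi _ _ ?_, hi _ _ ?_⟩ <;> decide⟩
      invFun p := fourCycleCopy p.2.1 p.2.2.1 p.2.2.2.1 p.2.2.2.2.1 p.2.2.2.2.2.1 p.2.2.2.2.2.2
      left_inv f := by
        ext i
        fin_cases i <;> rfl
      right_inv p := rfl }
  rw [Nat.card_congr e, Nat.card_eq_fintype_card, Fintype.card_subtype, Finset.card_filter]
  simp only [Fintype.sum_prod_type, closedFourCount]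

lemma card_copy_cycleGraph_six (G : SimpleGraph V) [DecidableRel G.Adj] :
    Nat.card (Copy (cycleGraph 6) G) = closedSixCount G := by
  let e : Copy (cycleGraph 6) G ≃ {p : V × V × V × V × V × V // G.Adj p.1 p.2.1 ∧
      G.Adj p.2.1 p.2.2.1 ∧ G.Adj p.2.2.1 p.2.2.2.1 ∧ G.Adj p.2.2.2.1 p.2.2.2.2.1 ∧
      G.Adj p.2.2.2.2.1 p.2.2.2.2.2 ∧ G.Adj p.2.2.2.2.2 p.1 ∧ p.1 ≠ p.2.2.1 ∧ p.1 ≠ p.2.2.2.1 ∧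
      p.1 ≠ p.2.2.2.2.1 ∧ p.2.1 ≠ p.2.2.2.1 ∧ p.2.1 ≠ p.2.2.2.2.1 ∧ p.2.1 ≠ p.2.2.2.2.2 ∧
      p.2.2.1 ≠ p.2.2.2.2.1 ∧ p.2.2.1 ≠ p.2.2.2.2.2 ∧ p.2.2.2.1 ≠ p.2.2.2.2.2} :=
    { toFun f := ⟨(f 0, f 1, f 2, f 3, f 4, f 5), by
        have hf (i j : Fin 6) (h : (cycleGraph 6).Adj i j) : G.Adj (f i) (f j) := f.toHom.map_adj h
        have hi (i j : Fin 6) (h : i ≠ j) : f i ≠ f j := f.injective.ne h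
        refine ⟨hf _ _ ?_, hf _ _ ?_, hf _ _ ?_, hf _ _ ?_, hf _ _ ?_, hf _ _ ?_, hi _ _ ?_,
          hi _ _ ?_, hi _ _ ?_, hi _ _ ?_, hi _ _ ?_, hi _ _ ?_, hi _ _ ?_, hi _ _ ?_,
          hi _ _ ?_⟩ <;> decide⟩
      invFun := fun ⟨_, h₁, h₂, h₃, h₄, h₅, h₆, n₁, n₂, n₃, n₄, n₅, n₆, n₇, n₈, n₉⟩ =>
        sixCycleCopy h₁ h₂ h₃ h₄ h₅ h₆ n₁ n₂ n₃ n₄ n₅ n₆ n₇ n₈ n₉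
      left_inv f := by
        ext i
        fin_cases i <;> rfl
      right_inv := fun ⟨_, _, _, _, _, _, _, _, _, _, _, _, _, _, _, _⟩ => rfl }
  rw [Nat.card_congr e, Nat.card_eq_fintype_card, Fintype.card_subtype, Finset.card_filter]
  simp only [Fintype.sum_prod_type, closedSixCount]

lemma closedFourCount_cycleGraph_four : closedFourCount (cycleGraph 4) = 8 := by
  decide +kernel

lemma closedSixCount_cycleGraph_six : closedSixCount (cycleGraph 6) = 12 := by
  have h : closedSixCount (cycleGraph 6) = ∑ a, ∑ b, if (cycleGraph 6).Adj a b then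
      ∑ c, if (cycleGraph 6).Adj b c then ∑ d, if (cycleGraph 6).Adj c d then
      ∑ e, if (cycleGraph 6).Adj d e then
      ∑ f, if (cycleGraph 6).Adj e f ∧ (cycleGraph 6).Adj f a ∧ a ≠ c ∧ a ≠ d ∧
      a ≠ e ∧ b ≠ d ∧ b ≠ e ∧ b ≠ f ∧ c ≠ e ∧ c ≠ f ∧ d ≠ f then 1 else 0 else 0 else 0 else 0
      else 0 := by
    simp only [closedSixCount, ite_sum_zero, ← ite_and]
  rw [h]
  decide +kernel

lemma closedFourCount_eq (G : SimpleGraph V) [DecidableRel G.Adj] :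
    closedFourCount G = numSubgraphs G (cycleGraph 4) * 8 := by
  rw [← card_copy_cycleGraph_four, card_copy_eq_numSubgraphs_mul, card_iso_eq_card_copy,
    card_copy_cycleGraph_four, closedFourCount_cycleGraph_four]

lemma closedSixCount_eq (G : SimpleGraph V) [DecidableRel G.Adj] :
    closedSixCount G = numSubgraphs G (cycleGraph 6) * 12 := by
  rw [← card_copy_cycleGraph_six, card_copy_eq_numSubgraphs_mul, card_iso_eq_card_copy,
    card_copy_cycleGraph_six, closedSixCount_cycleGraph_six]

/-- Two 4-cycles through a common path of length two share two edges. -/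
lemma false_of_three_common_neighbors {V : Type*} {G : SimpleGraph V}
    (hshare : ∀ H₁ H₂ : G.Subgraph, Nonempty (H₁.coe ≃g cycleGraph 4) →
      Nonempty (H₂.coe ≃g cycleGraph 4) → H₁ ≠ H₂ → (H₁.edgeSet ∩ H₂.edgeSet).ncard ≤ 1)
    [Finite V] {a b x y z : V} (hab : a ≠ b) (hxy : x ≠ y) (hxz : x ≠ z) (hyz : y ≠ z)
    (hax : G.Adj a x) (hay : G.Adj a y) (haz : G.Adj a z) (hbx : G.Adj b x) (hby : G.Adj b y)
    (hbz : G.Adj b z) : False := by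
  set f := fourCycleCopy hax hbx.symm hby hay.symm hab hxy
  set g := fourCycleCopy hax hbx.symm hbz haz.symm hab hxz
  have hne : f.toSubgraph ≠ g.toSubgraph := by
    intro h
    have hy : y ∈ f.toSubgraph.verts := ⟨3, trivial, rfl⟩
    rw [h] at hy
    obtain ⟨i, -, hi⟩ := hy
    fin_cases i
    exacts [hay.ne hi, hxy hi, hby.ne hi, hyz hi.symm]
  have h01 : (cycleGraph 4).Adj 0 1 := by decide
  have h12 : (cycleGraph 4).Adj 1 2 := by decide
  have h₁ : s(a, x) ∈ f.toSubgraph.edgeSet ∩ g.toSubgraph.edgeSet :=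
    ⟨⟨0, 1, h01, rfl, rfl⟩, ⟨0, 1, h01, rfl, rfl⟩⟩
  have h₂ : s(x, b) ∈ f.toSubgraph.edgeSet ∩ g.toSubgraph.edgeSet :=
    ⟨⟨1, 2, h12, rfl, rfl⟩, ⟨1, 2, h12, rfl, rfl⟩⟩
  have h := (Set.ncard_le_one (Set.toFinite _)).1
    (hshare _ _ ⟨f.isoToSubgraph.symm⟩ ⟨g.isoToSubgraph.symm⟩ hne) _ h₁ _ h₂
  rw [Sym2.eq_iff] at h
  grind

end Cycles

lemma isSparseCubic_of_regular {V : Type*} [Fintype V] [DecidableEq V] {G : SimpleGraph V}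
    [DecidableRel G.Adj] (hreg : G.IsRegularOfDegree 3) (C : G.Coloring (Fin 2))
    (hshare : ∀ H₁ H₂ : G.Subgraph, Nonempty (H₁.coe ≃g cycleGraph 4) →
      Nonempty (H₂.coe ≃g cycleGraph 4) → H₁ ≠ H₂ → (H₁.edgeSet ∩ H₂.edgeSet).ncard ≤ 1) :
    IsSparseCubic G fun v => decide (C v = 0) where
  card_neighborFinset v := (G.card_neighborFinset_eq_degree v).trans (hreg v)
  color_eq {u v} huv := by
    have := C.valid huv
    generalize C u = i at *
    generalize C v = j at *
    revert i j
    decide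
  not_common := false_of_three_common_neighbors hshare

theorem stmt_19 {V : Type*} [Fintype V] [DecidableEq V] (G : SimpleGraph V) [DecidableRel G.Adj]
    (hreg : G.IsRegularOfDegree 3) (hbip : G.Colorable 2) (h : ℕ)
    (hcard : Fintype.card V = 2 * h + 8)
    (hsix : numSubgraphs G (cycleGraph 4) = 6)
    (hshare : ∀ H₁ H₂ : G.Subgraph, Nonempty (H₁.coe ≃g cycleGraph 4) →
      Nonempty (H₂.coe ≃g cycleGraph 4) → H₁ ≠ H₂ →
      (H₁.edgeSet ∩ H₂.edgeSet).ncard ≤ 1)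
    (y : ℕ) (hy : y = numSubgraphs G dualSquare)
    (hsixcycles : numSubgraphs G (cycleGraph 6) = h + y) :
    (240 * numMatchings G 6 : ℤ) =
      243 * (h : ℤ) ^ 6 - 243 * (h : ℤ) ^ 5 - 1485 * (h : ℤ) ^ 4 + 6075 * (h : ℤ) ^ 3
        - 11238 * (h : ℤ) ^ 2 + 9768 * (h : ℤ) - 3840 + 240 * (y : ℤ) := by
  obtain ⟨C⟩ := hbip
  have hG := isSparseCubic_of_regular hreg C hshare
  have h4 : closedFourCount G = 48 := by rw [closedFourCount_eq, hsix]
  have h6 : closedSixCount G = 12 * (h + y) := by rw [closedSixCount_eq, hsixcycles, mul_comm]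
  have hm := hG.coeff_six_matchingSeries hcard h4 h6
  rw [matchingSeries, PowerSeries.coeff_mk, ← numMatchings_eq_card] at hm
  exact_mod_cast hm
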